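/- Let w** be an A_p* weight with constants a, c, and let g : (0,1] → [0,∞) be decreasing, right continuous, with ∫_0^1 g(t) dt = f and ∫_0^1 g(t)^p w**(t) dt = F < ∞. Then for every β > 0, the quantity Δ_w(g) = ∫_0^1 (t^{-1} ∫_0^t g(u) du)^p w**(t) dt satisfies Δ_w(g) ≤ (1 + 1/β) · [(β+1)^{p-1} (p-1)^p a^p F − (p-1) c f^p] / (p-1). -/

import Mathlib

open MeasureTheory Set Filter Topology

theorem mul_rpow_sub_one_mul_le {p x y l : ℝ} (hp : 1 < p) (hx : 0 ≤ x) (hy : 0 ≤ y)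
    (hl : 0 < l) :
    p * (x ^ (p - 1) * y) ≤ (p - 1) * l * x ^ p + (l ^ (p - 1))⁻¹ * y ^ p := by
  have hp0 : 0 < p := by linarith
  have hp1 : 0 < p - 1 := by linarith
  have h := Real.geom_mean_le_arith_mean2_weighted (w₁ := (p - 1) / p) (w₂ := 1 / p)
    (p₁ := l * x ^ p) (p₂ := (l ^ (p - 1))⁻¹ * y ^ p) (by positivity) (by positivity)
    (by positivity) (by positivity) (by field_simp; ring)
  have e₁ : (l * x ^ p) ^ ((p - 1) / p) = l ^ ((p - 1) / p) * x ^ (p - 1) := by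
    rw [Real.mul_rpow hl.le (by positivity), ← Real.rpow_mul hx]
    congr 2
    field_simp
  have e₂ : ((l ^ (p - 1))⁻¹ * y ^ p) ^ (1 / p) = (l ^ ((p - 1) / p))⁻¹ * y := by
    rw [Real.mul_rpow (by positivity) (by positivity), ← Real.rpow_mul hy,
      Real.inv_rpow (by positivity), ← Real.rpow_mul hl.le, mul_one_div, mul_one_div,
      div_self hp0.ne', Real.rpow_one]
  rw [e₁, e₂] at h
  have hl' : l ^ ((p - 1) / p) ≠ 0 := by positivity
  have e₃ : l ^ ((p - 1) / p) * x ^ (p - 1) * ((l ^ ((p - 1) / p))⁻¹ * y) = x ^ (p - 1) * y := by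
    field_simp
  rw [e₃] at h
  calc p * (x ^ (p - 1) * y)
      ≤ p * ((p - 1) / p * (l * x ^ p) + 1 / p * ((l ^ (p - 1))⁻¹ * y ^ p)) := by gcongr
    _ = _ := by field_simp

theorem integral_le_of_tendsto_ae {α : Type*} [MeasurableSpace α] {μ : Measure α}
    {u : ℕ → α → ℝ} {v : α → ℝ} {C : ℕ → ℝ} {c : ℝ} (hu : ∀ n, Integrable (u n) μ)
    (hu0 : ∀ n, 0 ≤ᵐ[μ] u n) (huv : ∀ᵐ x ∂μ, Tendsto (fun n => u n x) atTop (𝓝 (v x)))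
    (huC : ∀ n, ∫ x, u n x ∂μ ≤ C n) (hC : Tendsto C atTop (𝓝 c)) :
    ∫ x, v x ∂μ ≤ c := by
  have hc : 0 ≤ c := ge_of_tendsto' hC fun n => (integral_nonneg_of_ae (hu0 n)).trans (huC n)
  have hv0 : 0 ≤ᵐ[μ] v := by
    filter_upwards [huv, ae_all_iff.2 hu0] with x hx h0
    exact ge_of_tendsto' hx h0
  rw [integral_eq_lintegral_of_nonneg_ae hv0
    (aestronglyMeasurable_of_tendsto_ae atTop (fun n => (hu n).aestronglyMeasurable) huv)]
  refine ENNReal.toReal_le_of_le_ofReal hc ?_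
  calc ∫⁻ x, ENNReal.ofReal (v x) ∂μ
      = ∫⁻ x, liminf (fun n => ENNReal.ofReal (u n x)) atTop ∂μ := by
        refine lintegral_congr_ae ?_
        filter_upwards [huv] with x hx
        exact ((ENNReal.tendsto_ofReal hx).liminf_eq).symm
    _ ≤ liminf (fun n => ∫⁻ x, ENNReal.ofReal (u n x) ∂μ) atTop :=
        lintegral_liminf_le' fun n => (hu n).aestronglyMeasurable.aemeasurable.ennreal_ofReal
    _ ≤ liminf (fun n => ENNReal.ofReal (C n)) atTop := by
        refine liminf_le_liminf (Eventually.of_forall fun n => ?_)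
        rw [← ofReal_integral_eq_lintegral_ofReal (hu n) (hu0 n)]
        exact ENNReal.ofReal_le_ofReal (huC n)
    _ = ENNReal.ofReal c := (ENNReal.tendsto_ofReal hC).liminf_eq

theorem integral_primitive_mul_eq {a b : ℝ} (hab : a ≤ b) {k v : ℝ → ℝ}
    (hk : IntervalIntegrable k volume a b) (hv : IntervalIntegrable v volume a b) :
    ∫ t in a..b, (∫ s in a..t, k s) * v t = ∫ s in a..b, k s * ∫ t in s..b, v t := by
  rw [intervalIntegrable_iff_integrableOn_Ioc_of_le hab] at hk hv
  have hint : Integrable (Function.uncurry fun t s => (Iic t).indicator (fun s => k s * v t) s)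
      ((volume.restrict (Ioc a b)).prod (volume.restrict (Ioc a b))) := by
    have h := (hv.mul_prod hk).indicator (measurableSet_le measurable_snd measurable_fst)
    refine h.congr (Eventually.of_forall fun z => ?_)
    by_cases hz : z.2 ≤ z.1 <;> simp [indicator, Function.uncurry, hz, mul_comm]
  have hswap := integral_integral_swap hint
  rw [intervalIntegral.integral_of_le hab, intervalIntegral.integral_of_le hab]
  convert hswap using 1
  · refine setIntegral_congr_fun measurableSet_Ioc fun t ht => ?_
    rw [setIntegral_indicator measurableSet_Iic, integral_mul_const,
      intervalIntegral.integral_of_le ht.1.le, Ioc_inter_Iic, min_eq_right ht.2]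
  · refine setIntegral_congr_fun measurableSet_Ioc fun s hs => ?_
    have e : (fun t => (Iic t).indicator (fun s => k s * v t) s)
        = (Ici s).indicator fun t => k s * v t := by
      ext t
      simp [indicator]
    rw [e, setIntegral_indicator measurableSet_Ici, integral_const_mul,
      intervalIntegral.integral_of_le hs.2]
    congr 1
    rw [← integral_Icc_eq_integral_Ioc]
    congr 2
    ext t
    simp only [mem_inter_iff, mem_Ioc, mem_Ici, mem_Icc]
    exact ⟨fun h => ⟨⟨hs.1.trans_le h.1, h.2⟩, h.1⟩, fun h => ⟨h.2, h.1.2⟩⟩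

theorem integral_primitive_rpow_mul_le {p a c δ β : ℝ} (hp : 1 < p) (ha : 0 < a) (hβ : 0 < β)
    (hδ : 0 < δ) (hδ1 : δ ≤ 1) {w g : ℝ → ℝ}
    (hw : ∀ t ∈ Icc δ 1, 0 ≤ w t)
    (hv : IntervalIntegrable (fun s => w s / s ^ p) volume δ 1)
    (hAp : ∀ t ∈ Icc δ 1, (∫ s in t..1, w s / s ^ p) + c ≤ a * w t / t ^ (p - 1))
    (hg0 : ∀ t ∈ Icc δ 1, 0 ≤ g t)
    (hganti : AntitoneOn g (Icc δ 1))
    (hgrc : ∀ t ∈ Icc δ 1, ContinuousWithinAt g (Ici t) t)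
    (hgw : IntervalIntegrable (fun t => g t ^ p * w t) volume δ 1) :
    ∫ t in δ..1, (∫ s in δ..t, g s) ^ p * (w t / t ^ p) ≤
      (1 + 1 / β) * ((β + 1) ^ (p - 1) * (p - 1) ^ p * a ^ p * (∫ t in δ..1, g t ^ p * w t)
        - (p - 1) * c * (∫ s in δ..1, g s) ^ p) / (p - 1) := by
  have hp1 : 0 < p - 1 := by linarith
  have hp0 : 0 < p := by linarith
  have hu : uIcc δ 1 = Icc δ 1 := uIcc_of_le hδ1
  have hgI : IntervalIntegrable g volume δ 1 := by
    apply AntitoneOn.intervalIntegrable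
    rwa [hu]
  have hgIcc : IntegrableOn g (Icc δ 1) := by
    rwa [integrableOn_Icc_iff_integrableOn_Ioc, ← intervalIntegrable_iff_integrableOn_Ioc_of_le hδ1]
  have hgm : ∀ t ∈ Icc δ 1, IntervalIntegrable g volume δ t := fun t ht =>
    hgI.mono_set (by rw [hu, uIcc_of_le ht.1]; exact Icc_subset_Icc_right ht.2)
  set K : ℝ → ℝ := fun t => ∫ s in δ..t, g s with hK
  have hKcont : ContinuousOn K (Icc δ 1) := by
    rw [← hu]
    exact intervalIntegral.continuousOn_primitive_interval (by rwa [hu])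
  have hK0 : ∀ t ∈ Icc δ 1, 0 ≤ K t := fun t ht =>
    intervalIntegral.integral_nonneg ht.1 fun s hs => hg0 s ⟨hs.1, hs.2.trans ht.2⟩
  have hKrcont : ∀ q : ℝ, 0 ≤ q → ContinuousOn (fun t => K t ^ q) (Icc δ 1) := fun q hq =>
    hKcont.rpow_const fun t _ => Or.inr hq
  set k : ℝ → ℝ := fun s => p * K s ^ (p - 1) * g s with hk
  have hkI : IntervalIntegrable k volume δ 1 :=
    hgI.continuousOn_mul (by rw [hu]; exact continuousOn_const.mul (hKrcont _ hp1.le))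
  have hKder : ∀ t ∈ Ioo δ 1, HasDerivWithinAt (fun t => K t ^ p) (k t) (Ioi t) t := by
    intro t ht
    have ht' := Ioo_subset_Icc_self ht
    have h1 : HasDerivWithinAt K (g t) (Ici t) t := by
      refine intervalIntegral.integral_hasDerivWithinAt_right (hgm t ht') (t := Ioi t) ?_
        ((hgrc t ht').mono Ioi_subset_Ici_self)
      refine ⟨Icc δ 1, mem_nhdsWithin_of_mem_nhds (Icc_mem_nhds ht.1 ht.2),
        hgIcc.aestronglyMeasurable⟩
    have h2 := (h1.mono Ioi_subset_Ici_self).rpow_const (p := p) (Or.inr hp.le)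
    convert h2 using 1
    simp only [hk]
    ring
  have hKk : ∀ t ∈ Icc δ 1, ∫ s in δ..t, k s = K t ^ p := by
    intro t ht
    have hsub : Icc δ t ⊆ Icc δ 1 := Icc_subset_Icc_right ht.2
    rw [intervalIntegral.integral_eq_sub_of_hasDeriv_right_of_le ht.1
      ((hKrcont p hp0.le).mono hsub)
      (fun s hs => hKder s ⟨hs.1, hs.2.trans_le ht.2⟩)
      (hkI.mono_set (by rw [hu, uIcc_of_le ht.1]; exact hsub))]
    simp [hK, Real.zero_rpow hp0.ne']
  set v : ℝ → ℝ := fun s => w s / s ^ p with hvdef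
  set V : ℝ → ℝ := fun s => ∫ t in s..1, v t with hV
  have hVcont : ContinuousOn V (Icc δ 1) := by
    rw [← hu]
    refine intervalIntegral.continuousOn_primitive_interval_left ?_
    rwa [hu, integrableOn_Icc_iff_integrableOn_Ioc,
      ← intervalIntegrable_iff_integrableOn_Ioc_of_le hδ1]
  have hKvI : IntervalIntegrable (fun t => K t ^ p * v t) volume δ 1 :=
    hv.continuousOn_mul (hu ▸ hKrcont p hp0.le)
  have hkVI : IntervalIntegrable (fun t => k t * V t) volume δ 1 :=
    hkI.mul_continuousOn (hu ▸ hVcont)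
  set D := ∫ t in δ..1, K t ^ p * v t with hD
  set E := ∫ t in δ..1, g t ^ p * w t with hE
  have hparts : D = ∫ s in δ..1, k s * V s := by
    rw [← integral_primitive_mul_eq hδ1 hkI hv]
    refine intervalIntegral.integral_congr fun t ht => ?_
    rw [hu] at ht
    simp only [hKk t ht]
  set l : ℝ := ((p - 1) * (β + 1))⁻¹ with hl
  have hl0 : 0 < l := by positivity
  have hpt : ∀ t ∈ Icc δ 1, k t * V t ≤
      ((p - 1) * l * (K t ^ p * v t) + (l ^ (p - 1))⁻¹ * a ^ p * (g t ^ p * w t)) - c * k t := by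
    intro t ht
    have ht0 : 0 < t := hδ.trans_le ht.1
    have hkt : 0 ≤ k t := by
      have := hK0 t ht
      have := hg0 t ht
      positivity
    have h1 : k t * V t ≤ k t * (a * w t / t ^ (p - 1) - c) :=
      mul_le_mul_of_nonneg_left (by linarith [hAp t ht]) hkt
    have h2 := mul_le_mul_of_nonneg_right (mul_rpow_sub_one_mul_le hp
      (div_nonneg (hK0 t ht) ht0.le) (mul_nonneg ha.le (hg0 t ht)) hl0) (hw t ht)
    rw [Real.div_rpow (hK0 t ht) ht0.le, Real.div_rpow (hK0 t ht) ht0.le,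
      Real.mul_rpow ha.le (hg0 t ht)] at h2
    calc k t * V t ≤ k t * (a * w t / t ^ (p - 1) - c) := h1
      _ = p * (K t ^ (p - 1) / t ^ (p - 1) * (a * g t)) * w t - c * k t := by
        simp only [hk]; ring
      _ ≤ _ := by
        refine sub_le_sub_right (h2.trans_eq ?_) _
        simp only [hvdef]; ring
  have hmain : D ≤ (p - 1) * l * D + (l ^ (p - 1))⁻¹ * a ^ p * E - c * K 1 ^ p := by
    have h := intervalIntegral.integral_mono_on hδ1 hkVI
      (((hKvI.const_mul ((p - 1) * l)).add (hgw.const_mul ((l ^ (p - 1))⁻¹ * a ^ p))).sub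
        (hkI.const_mul c)) hpt
    rw [← hparts, intervalIntegral.integral_sub
      ((hKvI.const_mul ((p - 1) * l)).add (hgw.const_mul ((l ^ (p - 1))⁻¹ * a ^ p)))
      (hkI.const_mul c), intervalIntegral.integral_add
      (hKvI.const_mul ((p - 1) * l)) (hgw.const_mul ((l ^ (p - 1))⁻¹ * a ^ p)),
      intervalIntegral.integral_const_mul, intervalIntegral.integral_const_mul,
      intervalIntegral.integral_const_mul, hKk 1 ⟨hδ1, le_rfl⟩] at h
    exact h
  have e1 : (p - 1) * l = (β + 1)⁻¹ := by rw [hl]; field_simp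
  have e2 : (l ^ (p - 1))⁻¹ = (p - 1) ^ (p - 1) * (β + 1) ^ (p - 1) := by
    rw [hl, Real.inv_rpow (by positivity), inv_inv, Real.mul_rpow hp1.le (by positivity)]
  have e3 : (p - 1) ^ p = (p - 1) ^ (p - 1) * (p - 1) := by
    rw [← Real.rpow_add_one hp1.ne', sub_add_cancel]
  rw [e1, e2] at hmain
  rw [e3]
  calc D = (1 + 1 / β) * (D - (β + 1)⁻¹ * D) := by field_simp; ring
    _ ≤ (1 + 1 / β) * ((p - 1) ^ (p - 1) * (β + 1) ^ (p - 1) * a ^ p * E - c * K 1 ^ p) := by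
      refine mul_le_mul_of_nonneg_left ?_ (by positivity)
      linarith
    _ = _ := by
      simp only [hK]
      field_simp


/-- Let `w**` be an `A_p^*` weight with constants `a, c`, and let
`g : (0,1] → [0,∞)` be decreasing, right continuous, with `∫_0^1 g = f` and
`∫_0^1 g^p w** = F < ∞`. Then for every `β > 0`,
`Δ_w(g) = ∫_0^1 (t⁻¹ ∫_0^t g)^p w**(t) dt
  ≤ (1 + 1/β) ((β+1)^(p-1) (p-1)^p a^p F − (p-1) c f^p)/(p-1)`. -/
theorem ApStar_Delta_upper_bound (p a c f F : ℝ) (hp : 1 < p)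
    (ha : 0 < a) (hc : 0 < c) (w g : ℝ → ℝ)
    (hwpos : ∀ t ∈ Set.Ioc (0 : ℝ) 1, 0 < w t)
    (hloc : ∀ t ∈ Set.Ioc (0 : ℝ) 1,
      IntervalIntegrable (fun s => w s / s ^ p) MeasureTheory.volume t 1)
    (hAp : ∀ t ∈ Set.Ioc (0 : ℝ) 1,
      (∫ s in t..1, w s / s ^ p) + c ≤ a * w t / t ^ (p - 1))
    (hlim : Filter.Tendsto (fun t : ℝ => t ^ p * ∫ s in t..1, w s / s ^ p)
      (nhdsWithin 0 (Set.Ioi 0)) (nhds 0))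
    (hg0 : ∀ t ∈ Set.Ioc (0 : ℝ) 1, 0 ≤ g t)
    (hganti : AntitoneOn g (Set.Ioc 0 1))
    (hgrc : ∀ t ∈ Set.Ioc (0 : ℝ) 1, ContinuousWithinAt g (Set.Ici t) t)
    (hgint : MeasureTheory.IntegrableOn g (Set.Ioc 0 1))
    (hf : (∫ t in Set.Ioc (0 : ℝ) 1, g t) = f)
    (hFint : MeasureTheory.IntegrableOn (fun t => g t ^ p * w t) (Set.Ioc 0 1))
    (hF : (∫ t in Set.Ioc (0 : ℝ) 1, g t ^ p * w t) = F) :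
    ∀ β > (0 : ℝ),
      (∫ t in Set.Ioc (0 : ℝ) 1, (t⁻¹ * ∫ s in Set.Ioc 0 t, g s) ^ p * w t) ≤
        (1 + 1 / β) *
          ((β + 1) ^ (p - 1) * (p - 1) ^ p * a ^ p * F - (p - 1) * c * f ^ p) /
          (p - 1) := by
  intro β hβ
  have hp1 : 0 < p - 1 := by linarith
  have hp0 : 0 < p := by linarith
  set δ : ℕ → ℝ := fun n => 1 / ((n : ℝ) + 1) with hδ
  have hδ0 : ∀ n, 0 < δ n := fun n => Nat.one_div_pos_of_nat
  have hδ1 : ∀ n, δ n ≤ 1 := fun n => by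
    simp only [hδ]
    rw [div_le_one (by positivity)]
    linarith [(n.cast_nonneg : (0 : ℝ) ≤ n)]
  have hδlim : Tendsto δ atTop (𝓝 0) := tendsto_one_div_add_atTop_nhds_zero_nat
  have hsub : ∀ n, Icc (δ n) 1 ⊆ Ioc (0 : ℝ) 1 := fun n t ht => ⟨(hδ0 n).trans_le ht.1, ht.2⟩
  have hsub' : ∀ n, Ioc (δ n) 1 ⊆ Ioc (0 : ℝ) 1 := fun n => Ioc_subset_Icc_self.trans (hsub n)
  have hgIcc : IntegrableOn g (Icc 0 1) := by
    rwa [integrableOn_Icc_iff_integrableOn_Ioc]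
  have hprim : ∀ t ∈ Ioc (0 : ℝ) 1,
      Tendsto (fun n => ∫ s in δ n..t, g s) atTop (𝓝 (∫ s in (0 : ℝ)..t, g s)) := by
    intro t ht
    have hc : ContinuousOn (fun x => ∫ s in x..t, g s) (Icc 0 t) := by
      rw [← uIcc_of_le ht.1.le]
      refine intervalIntegral.continuousOn_primitive_interval_left ?_
      rw [uIcc_of_le ht.1.le]
      exact hgIcc.mono_set (Icc_subset_Icc_right ht.2)
    refine (hc 0 ⟨le_rfl, ht.1.le⟩).tendsto.comp (tendsto_nhdsWithin_iff.2 ⟨hδlim, ?_⟩)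
    filter_upwards [hδlim.eventually_lt_const ht.1] with n hn
    exact ⟨(hδ0 n).le, hn.le⟩
  have hcont : ∀ n, ContinuousOn (fun t => (∫ s in δ n..t, g s) ^ p) (uIcc (δ n) 1) := by
    intro n
    refine ContinuousOn.rpow_const ?_ fun t _ => Or.inr hp0.le
    refine intervalIntegral.continuousOn_primitive_interval ?_
    rw [uIcc_of_le (hδ1 n)]
    exact hgIcc.mono_set (Icc_subset_Icc_left (hδ0 n).le)
  have hint : ∀ n, IntegrableOn (fun t => (∫ s in δ n..t, g s) ^ p * (w t / t ^ p))
      (Ioc (δ n) 1) := fun n => by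
    rw [← intervalIntegrable_iff_integrableOn_Ioc_of_le (hδ1 n)]
    exact (hloc _ ⟨hδ0 n, hδ1 n⟩).continuousOn_mul (hcont n)
  refine integral_le_of_tendsto_ae
    (u := fun n => (Ioc (δ n) 1).indicator fun t => (∫ s in δ n..t, g s) ^ p * (w t / t ^ p))
    (C := fun n => (1 + 1 / β) * ((β + 1) ^ (p - 1) * (p - 1) ^ p * a ^ p * F
        - (p - 1) * c * (∫ s in δ n..1, g s) ^ p) / (p - 1))
    (fun n => ((hint n).integrable_indicator measurableSet_Ioc).restrict) ?_ ?_ ?_ ?_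
  · refine fun n => Eventually.of_forall fun t => indicator_nonneg (fun t ht => ?_) t
    have ht0 : 0 < t := (hδ0 n).trans ht.1
    refine mul_nonneg (Real.rpow_nonneg (intervalIntegral.integral_nonneg ht.1.le fun s hs => ?_) _)
      (div_nonneg (hwpos t (hsub' n ht)).le (by positivity))
    exact hg0 s (hsub n ⟨hs.1, hs.2.trans ht.2⟩)
  · refine (ae_restrict_iff' measurableSet_Ioc).2 (Eventually.of_forall fun t ht => ?_)
    have hG0 : 0 ≤ ∫ s in (0 : ℝ)..t, g s := by
      rw [intervalIntegral.integral_of_le ht.1.le]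
      exact setIntegral_nonneg measurableSet_Ioc fun s hs => hg0 s ⟨hs.1, hs.2.trans ht.2⟩
    have e : (t⁻¹ * ∫ s in Ioc 0 t, g s) ^ p * w t
        = (∫ s in (0 : ℝ)..t, g s) ^ p * (w t / t ^ p) := by
      rw [← intervalIntegral.integral_of_le ht.1.le,
        Real.mul_rpow (inv_nonneg.2 ht.1.le) hG0, Real.inv_rpow ht.1.le]
      ring
    rw [e]
    refine (((hprim t ht).rpow_const (Or.inr hp0.le)).mul_const _).congr' ?_
    filter_upwards [hδlim.eventually_lt_const ht.1] with n hn
    rw [indicator_of_mem (show t ∈ Ioc (δ n) 1 from ⟨hn, ht.2⟩)]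
  · intro n
    have hFn : ∫ t in δ n..1, g t ^ p * w t ≤ F := by
      rw [intervalIntegral.integral_of_le (hδ1 n), ← hF]
      refine setIntegral_mono_set hFint ?_ (hsub' n).eventuallyLE
      refine (ae_restrict_iff' measurableSet_Ioc).2 (Eventually.of_forall fun t ht => ?_)
      exact mul_nonneg (Real.rpow_nonneg (hg0 t ht) _) (hwpos t ht).le
    have h := integral_primitive_rpow_mul_le (c := c) hp ha hβ (hδ0 n) (hδ1 n)
      (fun t ht => (hwpos t (hsub n ht)).le) (hloc _ ⟨hδ0 n, hδ1 n⟩)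
      (fun t ht => hAp t (hsub n ht)) (fun t ht => hg0 t (hsub n ht)) (hganti.mono (hsub n))
      (fun t ht => hgrc t (hsub n ht))
      ((intervalIntegrable_iff_integrableOn_Ioc_of_le (hδ1 n)).2 (hFint.mono_set (hsub' n)))
    rw [setIntegral_indicator measurableSet_Ioc, inter_eq_right.2 (hsub' n),
      ← intervalIntegral.integral_of_le (hδ1 n)]
    refine h.trans ?_
    gcongr
  · have hlim1 := hprim 1 ⟨one_pos, le_rfl⟩
    rw [intervalIntegral.integral_of_le zero_le_one, hf] at hlim1
    exact ((((hlim1.rpow_const (Or.inr hp0.le)).const_mul _).const_sub _).const_mul _).div_const _
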